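/- If q ∈ (1,2) satisfies 0 < q − q_9 ≤ q_9^{−24}, then q ∈ B_3, i.e. there exists a point x ∈ I_q having exactly 3 base q expansions. -/

import Mathlib

open Set

/-- Projection map: the value of the (0-indexed) digit sequence `a` in base `q`,
`π_q(a) = Σ_{j=0}^∞ a_j q^{-(j+1)}`. -/
noncomputable def piQ (q : ℝ) (a : ℕ → ℝ) : ℝ := ∑' j : ℕ, a j / q ^ (j + 1)

/-- `a` is a sequence of digits in `{0,1}`. -/
def IsDigitSeq (a : ℕ → ℝ) : Prop := ∀ j, a j = 0 ∨ a j = 1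

/-- `a` is a sequence of digits in `{-1,0,1}`. -/
def IsExtDigitSeq (a : ℕ → ℝ) : Prop := ∀ j, a j = -1 ∨ a j = 0 ∨ a j = 1

/-- The set of base-`q` expansions of `x`. -/
def SigmaSet (q x : ℝ) : Set (ℕ → ℝ) := {a | IsDigitSeq a ∧ piQ q a = x}

/-- The interval `I_q = [0, 1/(q-1)]`. -/
def Iq (q : ℝ) : Set ℝ := Set.Icc 0 (1 / (q - 1))

/-- The switch region `J_q = [1/q, 1/(q(q-1))]`. -/
def Jq (q : ℝ) : Set ℝ := Set.Icc (1 / q) (1 / (q * (q - 1)))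

/-- The set of points of `I_q` having exactly `m` base-`q` expansions. -/
def UqM (q : ℝ) (m : ℕ∞) : Set ℝ := {x | x ∈ Iq q ∧ (SigmaSet q x).encard = m}

/-- The set of points of `I_q` having a unique base-`q` expansion. -/
def Uq (q : ℝ) : Set ℝ := UqM q 1

/-- `B_m`: the set of bases `q ∈ (1,2)` for which some point has exactly `m` expansions. -/
def Bset (m : ℕ∞) : Set ℝ := {q | q ∈ Set.Ioo (1 : ℝ) 2 ∧ (UqM q m).Nonempty}

/-- `x` is the `k`-Bonacci number: the root in `(1,2)` of `x^k = x^{k-1} + ⋯ + x + 1`. -/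
def IsBonacci (k : ℕ) (x : ℝ) : Prop :=
  x ∈ Set.Ioo (1 : ℝ) 2 ∧ x ^ k = ∑ i ∈ Finset.range k, x ^ i

/-- `a` contains no occurrence of the word `01^k` as a consecutive block. -/
def AvoidsWord01 (k : ℕ) (a : ℕ → ℝ) : Prop :=
  ∀ i, ¬(a i = 0 ∧ ∀ j, 1 ≤ j → j ≤ k → a (i + j) = 1)

/-- `a` contains no occurrence of the word `10^k` as a consecutive block. -/
def AvoidsWord10 (k : ℕ) (a : ℕ → ℝ) : Prop :=
  ∀ i, ¬(a i = 1 ∧ ∀ j, 1 ≤ j → j ≤ k → a (i + j) = 0)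

/-- `S_k`: the set of `{0,1}`-sequences avoiding the words `01^k` and `10^k`. -/
def Sset (k : ℕ) : Set (ℕ → ℝ) := {a | IsDigitSeq a ∧ AvoidsWord01 k a ∧ AvoidsWord10 k a}

/-- `g_{q,k} = f_1^{-(k-1)} ∘ f_0^{-1}`, where `f_0^{-1}(y) = y/q` and `f_1^{-1}(y) = (y+1)/q`. -/
noncomputable def gMap (q : ℝ) (k : ℕ) (x : ℝ) : ℝ := (fun y => (y + 1) / q)^[k - 1] (x / q)

/-- The maps `f_0(x) = qx` (for `b = false`) and `f_1(x) = qx - 1` (for `b = true`). -/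
noncomputable def fDigit (q : ℝ) (b : Bool) (x : ℝ) : ℝ := if b then q * x - 1 else q * x

/-- `(a, b)` is a bounded gap of `C`: a bounded connected component of `ℝ \ C`. -/
def IsGap (C : Set ℝ) (a b : ℝ) : Prop :=
  a < b ∧ a ∈ C ∧ b ∈ C ∧ Set.Ioo a b ∩ C = ∅

/-- The left endpoint of the bridge of `C` lying immediately to the left of the gap `(a, b)`:
the right endpoint of the nearest gap to the left having diameter at least `b - a`
(or `min C` if there is no such gap). -/
noncomputable def leftBridgeStart (C : Set ℝ) (a b : ℝ) : ℝ :=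
  sSup ({sInf C} ∪ {d | ∃ c, IsGap C c d ∧ d ≤ a ∧ b - a ≤ d - c})

/-- The right endpoint of the bridge of `C` lying immediately to the right of the gap `(a, b)`. -/
noncomputable def rightBridgeEnd (C : Set ℝ) (a b : ℝ) : ℝ :=
  sInf ({sSup C} ∪ {c | ∃ d, IsGap C c d ∧ b ≤ c ∧ b - a ≤ d - c})

/-- The (Newhouse) thickness of a compact set `C ⊆ ℝ`: the infimum over all bounded gaps `G`
of the ratio of the length of the bridge on either side of `G` to the length of `G`
(`∞` if `C` has no bounded gap). -/
noncomputable def thickness (C : Set ℝ) : ENNReal :=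
  ⨅ p : {p : ℝ × ℝ // IsGap C p.1 p.2},
    ENNReal.ofReal
      (min ((p.1.1 - leftBridgeStart C p.1.1 p.1.2) / (p.1.2 - p.1.1))
        ((rightBridgeEnd C p.1.1 p.1.2 - p.1.2) / (p.1.2 - p.1.1)))

/-- `B` is contained in a gap of `A`, i.e. in a connected component of `ℝ \ A`. -/
def ContainedInGap (B A : Set ℝ) : Prop :=
  ∃ x ∈ Aᶜ, B ⊆ connectedComponentIn Aᶜ x

/-- Two sets are interleaved if neither is contained in a gap of the other. -/
def Interleaved (A B : Set ℝ) : Prop :=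
  ¬ContainedInGap B A ∧ ¬ContainedInGap A B

/-- `A` and `B` are `ε`-strongly interleaved: any compact sets within Hausdorff distance `ε`
of `A` and `B` respectively are interleaved. -/
def StronglyInterleaved (ε : ℝ) (A B : Set ℝ) : Prop :=
  ∀ A' B' : Set ℝ, IsCompact A' → IsCompact B' →
    EMetric.hausdorffEdist A A' ≤ ENNReal.ofReal ε →
    EMetric.hausdorffEdist B B' ≤ ENNReal.ofReal ε → Interleaved A' B'

/-- The sequence `0^{k-3}(01^{k-1})^∞` (0-indexed). -/
noncomputable def seqG (k : ℕ) : ℕ → ℝ := fun j =>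
  if j < k - 3 then 0 else if (j - (k - 3)) % k = 0 then 0 else 1

/-- The sequence `1^{k-3}(10^{k-1})^∞` (0-indexed). -/
noncomputable def seqH (k : ℕ) : ℕ → ℝ := fun j =>
  if j < k - 3 then 1 else if (j - (k - 3)) % k = 0 then 1 else 0

/-- The sequence `(1^{k-1}0)^∞` (0-indexed). -/
noncomputable def seqP (k : ℕ) : ℕ → ℝ := fun j => if j % k = k - 1 then 0 else 1


/-! ### Expansions, shifts and forced digits -/

lemma IsDigitSeq.mem_Icc {a : ℕ → ℝ} (ha : IsDigitSeq a) (j : ℕ) : 0 ≤ a j ∧ a j ≤ 1 := by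
  rcases ha j with h | h <;> rw [h] <;> norm_num

lemma IsDigitSeq.shift {a : ℕ → ℝ} (ha : IsDigitSeq a) (n : ℕ) :
    IsDigitSeq fun j => a (n + j) := fun j => ha (n + j)

lemma hasSum_one_div_pow_succ {q : ℝ} (hq : 1 < q) :
    HasSum (fun j : ℕ => 1 / q ^ (j + 1)) (1 / (q - 1)) := by
  have h := (hasSum_geometric_of_lt_one (r := 1 / q) (by positivity)
    (by rw [div_lt_one (by linarith)]; exact hq)).mul_left (1 / q)
  have e : 1 / q * (1 - 1 / q)⁻¹ = 1 / (q - 1) := by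
    have : q - 1 ≠ 0 := by linarith
    have : q ≠ 0 := by linarith
    have : 1 - 1 / q ≠ 0 := by
      have : 1 - 1 / q = (q - 1) / q := by field_simp
      rw [this]; positivity
    field_simp
  rw [e] at h
  refine h.congr_fun fun j => ?_
  rw [← pow_succ', one_div_pow]

lemma IsDigitSeq.summable {q : ℝ} (hq : 1 < q) {a : ℕ → ℝ} (ha : IsDigitSeq a) :
    Summable fun j => a j / q ^ (j + 1) := by
  have hq0 : 0 < q := by linarith
  refine Summable.of_nonneg_of_le (fun j => ?_) (fun j => ?_) (hasSum_one_div_pow_succ hq).summable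
  · exact div_nonneg (ha.mem_Icc j).1 (by positivity)
  · exact div_le_div_of_nonneg_right (ha.mem_Icc j).2 (by positivity)

lemma digit_div_le_piQ {q : ℝ} (hq : 1 < q) {a : ℕ → ℝ} (ha : IsDigitSeq a) (i : ℕ) :
    a i / q ^ (i + 1) ≤ piQ q a := by
  have hq0 : 0 < q := by linarith
  exact (ha.summable hq).le_tsum i fun j _ => div_nonneg (ha.mem_Icc j).1 (by positivity)

lemma piQ_add_digit_compl_le {q : ℝ} (hq : 1 < q) {a : ℕ → ℝ} (ha : IsDigitSeq a) (i : ℕ) :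
    piQ q a + (1 - a i) / q ^ (i + 1) ≤ 1 / (q - 1) := by
  have hc : IsDigitSeq fun j => 1 - a j := by
    intro j
    rcases ha j with h | h <;> simp [h]
  have h1 := digit_div_le_piQ hq hc i
  have h2 : piQ q (fun j => 1 - a j) + piQ q a = 1 / (q - 1) := by
    rw [← (hasSum_one_div_pow_succ hq).tsum_eq, piQ, piQ,
      ← (hc.summable hq).tsum_add (ha.summable hq)]
    congr 1
    ext j
    ring
  linarith

lemma piQ_mem_Icc {q : ℝ} (hq : 1 < q) {a : ℕ → ℝ} (ha : IsDigitSeq a) :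
    0 ≤ piQ q a ∧ piQ q a ≤ 1 / (q - 1) := by
  have hq0 : 0 < q := by linarith
  have h1 : 0 ≤ a 0 / q ^ (0 + 1) := div_nonneg (ha.mem_Icc 0).1 (by positivity)
  have h2 : 0 ≤ (1 - a 0) / q ^ (0 + 1) :=
    div_nonneg (by linarith [(ha.mem_Icc 0).2]) (by positivity)
  exact ⟨by linarith [digit_div_le_piQ hq ha 0], by linarith [piQ_add_digit_compl_le hq ha 0]⟩

lemma mul_piQ {q : ℝ} (hq : 1 < q) {a : ℕ → ℝ} (ha : IsDigitSeq a) :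
    q * piQ q a = a 0 + piQ q fun j => a (1 + j) := by
  have hq0 : q ≠ 0 := by linarith
  rw [piQ, (ha.summable hq).tsum_eq_zero_add, mul_add, ← tsum_mul_left, piQ]
  congr 1
  · field_simp
    ring
  · congr 1
    ext j
    rw [add_comm 1 j, pow_succ q (j + 1)]
    field_simp

lemma mul_piQ_shift {q : ℝ} (hq : 1 < q) {a : ℕ → ℝ} (ha : IsDigitSeq a) (n : ℕ) :
    q * piQ q (fun j => a (n + j)) = a n + piQ q fun j => a (n + 1 + j) := by
  have h := mul_piQ hq (ha.shift n)
  simpa [add_assoc] using h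

lemma pow_mul_piQ {q : ℝ} (hq : 1 < q) {a : ℕ → ℝ} (ha : IsDigitSeq a) (n : ℕ) :
    q ^ n * piQ q a =
      ∑ i ∈ Finset.range n, a i * q ^ (n - 1 - i) + piQ q fun j => a (n + j) := by
  induction n with
  | zero => simp
  | succ n ih =>
    have h := mul_piQ_shift hq ha n
    have e : ∑ i ∈ Finset.range n, a i * q ^ (n + 1 - 1 - i) =
        q * ∑ i ∈ Finset.range n, a i * q ^ (n - 1 - i) := by
      rw [Finset.mul_sum]
      refine Finset.sum_congr rfl fun i hi => ?_
      have hi := Finset.mem_range.1 hi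
      rw [show n + 1 - 1 - i = (n - 1 - i) + 1 by omega]
      ring
    rw [Finset.sum_range_succ, e]
    simp only [Nat.add_sub_cancel, Nat.sub_self, pow_zero, mul_one]
    rw [pow_succ]
    linear_combination q * ih + h

/-- The digit at position `n` recurs within the next seven positions. -/
def DigitRecurs (a : ℕ → ℝ) (n : ℕ) : Prop := ∃ i < 7, a (n + 1 + i) = a n

lemma digit_eq_of_recurs {q : ℝ} (hq : 1 < q) (hgap : 1 / (q - 1) < 1 + 1 / q ^ 7)
    {a b : ℕ → ℝ} (ha : IsDigitSeq a) (hb : IsDigitSeq b) {n : ℕ}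
    (h : piQ q (fun j => a (n + j)) = piQ q fun j => b (n + j)) (hr : DigitRecurs a n) :
    b n = a n := by
  have hq0 : 0 < q := by linarith
  obtain ⟨i, hi, hai⟩ := hr
  have h1 := mul_piQ_shift hq ha n
  have h2 := mul_piQ_shift hq hb n
  rw [h] at h1
  have hpow : 1 / q ^ 7 ≤ 1 / q ^ (i + 1) :=
    one_div_le_one_div_of_le (by positivity) (pow_le_pow_right₀ hq.le (by omega))
  have l1 := digit_div_le_piQ hq (ha.shift (n + 1)) i
  have l2 := piQ_add_digit_compl_le hq (ha.shift (n + 1)) i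
  have l3 := piQ_mem_Icc hq (hb.shift (n + 1))
  simp only [hai] at l1 l2
  rcases ha n with e | e <;> rcases hb n with e' | e' <;> rw [e, e'] <;> exfalso <;>
    rw [e] at h1 l1 l2 <;> rw [e'] at h2 <;> simp only [sub_zero, sub_self] at l2 <;> linarith

lemma digits_eq_of_recurs {q : ℝ} (hq : 1 < q) (hgap : 1 / (q - 1) < 1 + 1 / q ^ 7)
    {a b : ℕ → ℝ} (ha : IsDigitSeq a) (hb : IsDigitSeq b) {m : ℕ}
    (h : piQ q (fun j => a (m + j)) = piQ q fun j => b (m + j)) (k : ℕ)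
    (hr : ∀ n, m ≤ n → n < m + k → DigitRecurs a n) :
    (∀ n, m ≤ n → n < m + k → b n = a n) ∧
      piQ q (fun j => a (m + k + j)) = piQ q fun j => b (m + k + j) := by
  induction k with
  | zero => exact ⟨fun n h1 h2 => by omega, by simpa using h⟩
  | succ k ih =>
    obtain ⟨i1, i2⟩ := ih fun n h1 h2 => hr n h1 (by omega)
    have hd := digit_eq_of_recurs hq hgap ha hb i2 (hr _ (by omega) (by omega))
    refine ⟨fun n h1 h2 => ?_, ?_⟩
    · rcases Nat.lt_succ_iff_lt_or_eq.1 (show n < (m + k).succ by omega) with h3 | h3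
      · exact i1 n h1 h3
      · rw [h3, hd]
    · have h1 := mul_piQ_shift hq ha (m + k)
      have h2 := mul_piQ_shift hq hb (m + k)
      rw [i2, h2, hd] at h1
      simpa [add_assoc] using h1.symm

lemma tail_eq_of_recurs {q : ℝ} (hq : 1 < q) (hgap : 1 / (q - 1) < 1 + 1 / q ^ 7)
    {a b : ℕ → ℝ} (ha : IsDigitSeq a) (hb : IsDigitSeq b) {m : ℕ}
    (h : piQ q (fun j => a (m + j)) = piQ q fun j => b (m + j))
    (hr : ∀ n, m ≤ n → DigitRecurs a n) (n : ℕ) (hn : m ≤ n) : b n = a n :=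
  (digits_eq_of_recurs hq hgap ha hb h (n + 1) fun n h1 _ => hr n h1).1 n hn (by omega)

/-! ### Sequences of binary blocks of length four -/

/-- The concatenation of the four-digit binary expansions of the numbers `w n`. -/
def blockSeq (w : ℕ → ℕ) (j : ℕ) : ℝ := ((w (j / 4) / 2 ^ (3 - j % 4) % 2 : ℕ) : ℝ)

/-- The value in base `q` of a four-digit binary word. -/
def wordVal (q : ℝ) (n : ℕ) : ℝ :=
  ((n / 8 % 2 : ℕ) : ℝ) * q ^ 3 + ((n / 4 % 2 : ℕ) : ℝ) * q ^ 2 + ((n / 2 % 2 : ℕ) : ℝ) * q +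
    ((n % 2 : ℕ) : ℝ)

lemma isDigitSeq_blockSeq (w : ℕ → ℕ) : IsDigitSeq (blockSeq w) := by
  intro j
  rcases Nat.mod_two_eq_zero_or_one (w (j / 4) / 2 ^ (3 - j % 4)) with h | h <;>
    simp [blockSeq, h]

lemma exists_digit_eq (w d : ℕ) (hw : 1 ≤ w ∧ w ≤ 14) (hd : d < 2) :
    ∃ i < 4, w / 2 ^ (3 - i) % 2 = d := by
  obtain ⟨h1, h2⟩ := hw
  interval_cases w <;> interval_cases d <;> decide

lemma blockSeq_block {w : ℕ → ℕ} (hw : ∀ n, 1 ≤ w n ∧ w n ≤ 14) (n : ℕ) {x : ℝ}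
    (hx : x = 0 ∨ x = 1) : ∃ i < 4, blockSeq w (4 * n + i) = x := by
  obtain ⟨d, hd, rfl⟩ : ∃ d : ℕ, d < 2 ∧ x = d := by
    rcases hx with rfl | rfl
    · exact ⟨0, by simp⟩
    · exact ⟨1, by simp⟩
  obtain ⟨i, hi, h⟩ := exists_digit_eq (w n) d (hw n) hd
  refine ⟨i, hi, ?_⟩
  rw [blockSeq, show (4 * n + i) / 4 = n by omega, show (4 * n + i) % 4 = i by omega, h]

lemma digitRecurs_blockSeq {w : ℕ → ℕ} (hw : ∀ n, 1 ≤ w n ∧ w n ≤ 14) (n : ℕ) :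
    DigitRecurs (blockSeq w) n := by
  obtain ⟨i, hi, h⟩ := blockSeq_block hw (n / 4 + 1) (isDigitSeq_blockSeq w n)
  refine ⟨4 * (n / 4 + 1) + i - (n + 1), by omega, ?_⟩
  rwa [show n + 1 + (4 * (n / 4 + 1) + i - (n + 1)) = 4 * (n / 4 + 1) + i by omega]

lemma pow_four_mul_piQ_blockSeq {q : ℝ} (hq : 1 < q) (w : ℕ → ℕ) :
    q ^ 4 * piQ q (blockSeq w) = wordVal q (w 0) + piQ q (blockSeq fun n => w (n + 1)) := by
  have h := pow_mul_piQ hq (isDigitSeq_blockSeq w) 4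
  have e : (fun j => blockSeq w (4 + j)) = blockSeq fun n => w (n + 1) := by
    ext j
    simp only [blockSeq]
    rw [show (4 + j) / 4 = j / 4 + 1 by omega, show (4 + j) % 4 = j % 4 by omega]
  rw [e] at h
  rw [h]
  simp [Finset.sum_range_succ, blockSeq, wordVal]

lemma wordVal_mem_Icc {q : ℝ} (h1 : 1.998 ≤ q) (h2 : q ≤ 2) {w : ℕ} (hw : 1 ≤ w ∧ w ≤ 14) :
    (w : ℝ) - 0.034 ≤ wordVal q w ∧ wordVal q w ≤ w := by
  have a1 : (1.998 : ℝ) ^ 2 ≤ q ^ 2 := by gcongr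
  have a2 : (1.998 : ℝ) ^ 3 ≤ q ^ 3 := by gcongr
  have b1 : q ^ 2 ≤ (2 : ℝ) ^ 2 := by gcongr
  have b2 : q ^ 3 ≤ (2 : ℝ) ^ 3 := by gcongr
  obtain ⟨l, u⟩ := hw
  norm_num at a1 a2 b1 b2
  interval_cases w <;> norm_num [wordVal] <;> constructor <;> linarith

/-- A vector of `ℝ²` is rounded to an integer vector with hexagonally small error. -/
lemma exists_int_near (X Y : ℝ) : ∃ m n : ℤ, |X - m| ≤ 3 / 4 ∧ |Y - n| ≤ 3 / 4 ∧
    |X + Y - (m + n)| ≤ 3 / 4 := by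
  have h := abs_le.1 (abs_sub_round X)
  rcases le_total 0 (X - round X) with h0 | h0
  · have h1 := Int.le_ceil (Y - 1 / 4)
    have h2 := Int.ceil_lt_add_one (Y - 1 / 4)
    refine ⟨round X, ⌈Y - 1 / 4⌉, ?_, ?_, ?_⟩ <;> rw [abs_le] <;> constructor <;> linarith
  · have h1 := Int.floor_le (Y + 1 / 4)
    have h2 := Int.lt_floor_add_one (Y + 1 / 4)
    refine ⟨round X, ⌊Y + 1 / 4⌋, ?_, ?_, ?_⟩ <;> rw [abs_le] <;> constructor <;> linarith

lemma exists_words_of_int {m n : ℤ} (hm : |m| ≤ 13) (hn : |n| ≤ 13) (hmn : |m + n| ≤ 13) :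
    ∃ t s p : ℕ, (1 ≤ t ∧ t ≤ 14) ∧ (1 ≤ s ∧ s ≤ 14) ∧ (1 ≤ p ∧ p ≤ 14) ∧
      (t : ℤ) - s = m ∧ (s : ℤ) - p = n := by
  rw [abs_le] at hm hn hmn
  have h : ∃ s : ℤ, 1 ≤ s ∧ s ≤ 14 ∧ 1 ≤ s + m ∧ s + m ≤ 14 ∧ 1 ≤ s - n ∧ s - n ≤ 14 :=
    ⟨1 + max 0 (max (-m) n), by omega⟩
  obtain ⟨s, h⟩ := h
  exact ⟨(s + m).toNat, s.toNat, (s - n).toNat, by omega, by omega, by omega, by omega, by omega⟩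

/-- The hexagon of pairs of differences that are realised by block sequences. -/
def hexagon : Set (ℝ × ℝ) := {x | |x.1| ≤ 0.785 ∧ |x.2| ≤ 0.785 ∧ |x.1 + x.2| ≤ 0.785}

lemma exists_words {q : ℝ} (h1 : 1.998 ≤ q) (h2 : q ≤ 1.9981) {x : ℝ × ℝ} (hx : x ∈ hexagon) :
    ∃ t s p : ℕ, (1 ≤ t ∧ t ≤ 14) ∧ (1 ≤ s ∧ s ≤ 14) ∧ (1 ≤ p ∧ p ≤ 14) ∧
      (q ^ 4 * x.1 - (wordVal q t - wordVal q s),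
        q ^ 4 * x.2 - (wordVal q s - wordVal q p)) ∈ hexagon := by
  obtain ⟨x, y⟩ := x
  obtain ⟨hx, hy, hxy⟩ := hx
  simp only at hx hy hxy ⊢
  have hq4 : q ^ 4 ≤ 16 := by
    calc q ^ 4 ≤ 1.9981 ^ 4 := by gcongr
      _ ≤ 16 := by norm_num
  have key : ∀ z : ℝ, |z| ≤ 0.785 → |q ^ 4 * z| ≤ 12.56 := by
    intro z hz
    rw [abs_mul, abs_of_nonneg (by positivity : (0 : ℝ) ≤ q ^ 4)]
    calc q ^ 4 * |z| ≤ 16 * 0.785 := by gcongr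
      _ = 12.56 := by norm_num
  have kx := abs_le.1 (key x hx)
  have ky := abs_le.1 (key y hy)
  have kxy := abs_le.1 (key _ hxy)
  rw [mul_add] at kxy
  obtain ⟨m, n, em, en, emn⟩ := exists_int_near (q ^ 4 * x) (q ^ 4 * y)
  rw [abs_le] at em en emn
  have bound : ∀ k : ℤ, (-14 : ℝ) < k → (k : ℝ) < 14 → |k| ≤ 13 := by
    intro k l u
    have l' : -14 < k := by exact_mod_cast l
    have u' : k < 14 := by exact_mod_cast u
    rw [abs_le]
    omega
  obtain ⟨t, s, p, ht, hs, hp, e1, e2⟩ := exists_words_of_int (m := m) (n := n)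
    (bound m (by linarith) (by linarith)) (bound n (by linarith) (by linarith))
    (bound (m + n) (by push_cast; linarith) (by push_cast; linarith))
  have f1 : (t : ℝ) - s = m := by exact_mod_cast e1
  have f2 : (s : ℝ) - p = n := by exact_mod_cast e2
  have vt := wordVal_mem_Icc h1 (by linarith) ht
  have vs := wordVal_mem_Icc h1 (by linarith) hs
  have vp := wordVal_mem_Icc h1 (by linarith) hp
  refine ⟨t, s, p, ht, hs, hp, ?_, ?_, ?_⟩ <;> simp only [abs_le] <;> constructor <;> linarith

lemma eq_zero_of_expanding_bounded {r C : ℝ} (hr : 1 < r) (h : ℕ → ℝ)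
    (hs : ∀ n, h (n + 1) = r * h n) (hb : ∀ n, |h n| ≤ C) : h 0 = 0 := by
  have hp : ∀ n, h n = r ^ n * h 0 := by
    intro n
    induction n with
    | zero => simp
    | succ n ih => rw [hs, ih, pow_succ]; ring
  by_contra h0
  have h0' : 0 < |h 0| := abs_pos.2 h0
  obtain ⟨n, hn⟩ := pow_unbounded_of_one_lt (C / |h 0|) hr
  have h1 := hb n
  rw [hp, abs_mul, abs_of_pos (by positivity)] at h1
  rw [div_lt_iff₀ h0'] at hn
  linarith

lemma piQ_blockSeq_sub {q : ℝ} (hq : 1 < q) {t s : ℕ → ℕ} {x : ℕ → ℝ} {C : ℝ}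
    (hx : ∀ n, |x n| ≤ C)
    (hstep : ∀ n, x (n + 1) = q ^ 4 * x n - (wordVal q (t n) - wordVal q (s n))) :
    piQ q (blockSeq t) - piQ q (blockSeq s) = x 0 := by
  have h := eq_zero_of_expanding_bounded (r := q ^ 4) (C := 1 / (q - 1) + C)
    (one_lt_pow₀ hq (by norm_num))
    (fun n => piQ q (blockSeq fun k => t (n + k)) - piQ q (blockSeq fun k => s (n + k)) - x n)
    (fun n => ?_) (fun n => ?_)
  · simp only [zero_add] at h
    linarith
  · have e1 := pow_four_mul_piQ_blockSeq hq fun k => t (n + k)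
    have e2 := pow_four_mul_piQ_blockSeq hq fun k => s (n + k)
    simp only [add_zero] at e1 e2
    have r1 : (fun k => t (n + 1 + k)) = fun k => t (n + (k + 1)) := by
      ext k; congr 1; ring
    have r2 : (fun k => s (n + 1 + k)) = fun k => s (n + (k + 1)) := by
      ext k; congr 1; ring
    simp only [r1, r2, hstep]
    linear_combination e2 - e1
  · have b1 := piQ_mem_Icc hq (isDigitSeq_blockSeq fun k => t (n + k))
    have b2 := piQ_mem_Icc hq (isDigitSeq_blockSeq fun k => s (n + k))
    have b3 := abs_le.1 (hx n)
    rw [abs_le]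
    constructor <;> linarith

lemma exists_blockSeqs {q : ℝ} (h1 : 1.998 ≤ q) (h2 : q ≤ 1.9981) {x : ℝ × ℝ}
    (hx : x ∈ hexagon) :
    ∃ t s p : ℕ → ℕ, (∀ n, 1 ≤ t n ∧ t n ≤ 14) ∧ (∀ n, 1 ≤ s n ∧ s n ≤ 14) ∧
      (∀ n, 1 ≤ p n ∧ p n ≤ 14) ∧
      piQ q (blockSeq t) - piQ q (blockSeq s) = x.1 ∧
      piQ q (blockSeq s) - piQ q (blockSeq p) = x.2 := by
  have hq : 1 < q := by linarith
  choose t s p ht hs hp hstep using fun z : hexagon => exists_words h1 h2 z.2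
  let z : ℕ → hexagon := fun n => Nat.rec ⟨x, hx⟩ (fun _ y => ⟨_, hstep y⟩) n
  refine ⟨fun n => t (z n), fun n => s (z n), fun n => p (z n), fun n => ht _, fun n => hs _,
    fun n => hp _, ?_, ?_⟩
  · exact piQ_blockSeq_sub hq (x := fun n => (z n).1.1) (fun n => (z n).2.1) fun n => rfl
  · exact piQ_blockSeq_sub hq (x := fun n => (z n).1.2) (fun n => (z n).2.2.1) fun n => rfl

/-! ### Sequences starting with a given finite word -/

/-- The sequence that follows `c` on the first `k` positions and continues with `a`. -/
def wordThenSeq (k : ℕ) (c : ℕ → ℝ) (a : ℕ → ℝ) (j : ℕ) : ℝ := if j < k then c j else a (j - k)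

lemma wordThenSeq_of_lt {k : ℕ} {c a : ℕ → ℝ} {j : ℕ} (h : j < k) : wordThenSeq k c a j = c j :=
  if_pos h

lemma wordThenSeq_add {k : ℕ} {c a : ℕ → ℝ} (j : ℕ) : wordThenSeq k c a (k + j) = a j := by
  simp [wordThenSeq]

lemma IsDigitSeq.wordThenSeq {k : ℕ} {c a : ℕ → ℝ} (hc : IsDigitSeq c) (ha : IsDigitSeq a) :
    IsDigitSeq (wordThenSeq k c a) := by
  intro j
  unfold _root_.wordThenSeq
  split_ifs
  exacts [hc j, ha _]

lemma pow_mul_piQ_wordThenSeq {q : ℝ} (hq : 1 < q) {k : ℕ} {c a : ℕ → ℝ} (hc : IsDigitSeq c)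
    (ha : IsDigitSeq a) : q ^ k * piQ q (wordThenSeq k c a) =
      ∑ i ∈ Finset.range k, c i * q ^ (k - 1 - i) + piQ q a := by
  rw [pow_mul_piQ hq (hc.wordThenSeq ha)]
  simp only [wordThenSeq_add]
  congr 1
  exact Finset.sum_congr rfl fun i hi => by rw [wordThenSeq_of_lt (Finset.mem_range.1 hi)]

/-- In a constant stretch `m ≤ n < k` followed by blocks, every digit recurs soon. -/
lemma digitRecurs_wordThenSeq {k m : ℕ} {c : ℕ → ℝ} {w : ℕ → ℕ}
    (hw : ∀ n, 1 ≤ w n ∧ w n ≤ 14) {x : ℝ} (hx : x = 0 ∨ x = 1)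
    (hc : ∀ n, m ≤ n → n < k → c n = x) (n : ℕ) (hn : m ≤ n) :
    DigitRecurs (wordThenSeq k c (blockSeq w)) n := by
  rcases lt_trichotomy (n + 1) k with h | h | h
  · refine ⟨0, by norm_num, ?_⟩
    rw [add_zero, wordThenSeq_of_lt h, wordThenSeq_of_lt (by omega), hc _ (by omega) h,
      hc _ hn (by omega)]
  · obtain ⟨i, hi, e⟩ := blockSeq_block hw 0 hx
    rw [mul_zero, zero_add] at e
    refine ⟨i, by omega, ?_⟩
    rw [h, wordThenSeq_add, e, wordThenSeq_of_lt (by omega), hc _ hn (by omega)]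
  · obtain ⟨j, rfl⟩ : ∃ j, n = k + j := ⟨n - k, by omega⟩
    obtain ⟨i, hi, e⟩ := digitRecurs_blockSeq hw j
    refine ⟨i, hi, ?_⟩
    rw [wordThenSeq_add, show k + j + 1 + i = k + (j + 1 + i) by omega, wordThenSeq_add, e]

/-- The word `01⁸01⁹`, extended by ones. -/
def lowerWord (j : ℕ) : ℝ := if j = 0 ∨ j = 9 then 0 else 1

/-- The word `01⁹0⁹`, extended by zeros. -/
def middleWord (j : ℕ) : ℝ := if 1 ≤ j ∧ j ≤ 9 then 1 else 0

/-- The word `10¹⁸`, extended by zeros. -/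
def upperWord (j : ℕ) : ℝ := if j = 0 then 1 else 0

lemma isDigitSeq_lowerWord : IsDigitSeq lowerWord := by
  intro j; unfold lowerWord; split_ifs <;> simp

lemma isDigitSeq_middleWord : IsDigitSeq middleWord := by
  intro j; unfold middleWord; split_ifs <;> simp

lemma isDigitSeq_upperWord : IsDigitSeq upperWord := by
  intro j; unfold upperWord; split_ifs <;> simp

lemma digitRecurs_lowerWord (a : ℕ → ℝ) (n : ℕ) (h1 : 1 ≤ n) (h2 : n < 9) :
    DigitRecurs (wordThenSeq 19 lowerWord a) n := by
  rcases Nat.lt_or_ge n 8 with h | h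
  · refine ⟨0, by norm_num, ?_⟩
    rw [wordThenSeq_of_lt (by omega), wordThenSeq_of_lt (by omega), lowerWord, lowerWord,
      if_neg (by omega), if_neg (by omega)]
  · refine ⟨1, by norm_num, ?_⟩
    rw [wordThenSeq_of_lt (by omega), wordThenSeq_of_lt (by omega), lowerWord, lowerWord,
      if_neg (by omega), if_neg (by omega)]

lemma eq_wordThenSeq {b c a : ℕ → ℝ} {k m : ℕ} (h : ∀ n < m, b n = c n) (hm : m ≤ k)
    (h' : ∀ n, m ≤ n → b n = wordThenSeq k c a n) : b = wordThenSeq k c a := by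
  ext n
  rcases Nat.lt_or_ge n m with hn | hn
  · rw [h n hn, wordThenSeq_of_lt (by omega)]
  · exact h' n hn

/-- If the defects of the identities `q⁹ = q⁸ + ⋯ + 1` and `q¹⁸ = q¹⁷ + ⋯ + q⁹` are differences of
values of block sequences, then some point has exactly three expansions. -/
lemma mem_Bset_three {q : ℝ} (hq : q ∈ Ioo (1 : ℝ) 2) (hgap : 1 / (q - 1) < 1 + 1 / q ^ 7)
    {t s p : ℕ → ℕ} (ht : ∀ n, 1 ≤ t n ∧ t n ≤ 14) (hs : ∀ n, 1 ≤ s n ∧ s n ≤ 14)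
    (hp : ∀ n, 1 ≤ p n ∧ p n ≤ 14)
    (hts : piQ q (blockSeq t) - piQ q (blockSeq s) = q ^ 9 - ∑ i ∈ Finset.range 9, q ^ i)
    (hsp : piQ q (blockSeq s) - piQ q (blockSeq p) =
      q ^ 9 * (q ^ 9 - ∑ i ∈ Finset.range 9, q ^ i)) : q ∈ Bset 3 := by
  have hq1 := hq.1
  set A := wordThenSeq 19 lowerWord (blockSeq t) with hA
  set B := wordThenSeq 19 middleWord (blockSeq s) with hB
  set C := wordThenSeq 19 upperWord (blockSeq p) with hC
  have dA : IsDigitSeq A := isDigitSeq_lowerWord.wordThenSeq (isDigitSeq_blockSeq t)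
  have dB : IsDigitSeq B := isDigitSeq_middleWord.wordThenSeq (isDigitSeq_blockSeq s)
  have dC : IsDigitSeq C := isDigitSeq_upperWord.wordThenSeq (isDigitSeq_blockSeq p)
  have vA := pow_mul_piQ_wordThenSeq hq1 (k := 19) isDigitSeq_lowerWord (isDigitSeq_blockSeq t)
  have vB := pow_mul_piQ_wordThenSeq hq1 (k := 19) isDigitSeq_middleWord (isDigitSeq_blockSeq s)
  have vC := pow_mul_piQ_wordThenSeq hq1 (k := 19) isDigitSeq_upperWord (isDigitSeq_blockSeq p)
  simp [Finset.sum_range_succ, lowerWord] at vA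
  simp [Finset.sum_range_succ, middleWord] at vB
  simp [upperWord] at vC
  simp only [Finset.sum_range_succ, Finset.sum_range_zero] at hts hsp
  have hq19 : q ^ 19 ≠ 0 := by positivity
  have eAB : piQ q B = piQ q A := mul_left_cancel₀ hq19 (by linear_combination vB - vA - hts)
  have eAC : piQ q C = piQ q A :=
    mul_left_cancel₀ hq19 (by linear_combination vC - vA - hts - hsp)
  have A0 : A 0 = 0 := by simp [hA, wordThenSeq, lowerWord]
  have B0 : B 0 = 0 := by simp [hB, wordThenSeq, middleWord]
  have C0 : C 0 = 1 := by simp [hC, wordThenSeq, upperWord]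
  have A9 : A 9 = 0 := by simp [hA, wordThenSeq, lowerWord]
  have B9 : B 9 = 1 := by simp [hB, wordThenSeq, middleWord]
  have hAB : A ≠ B := fun h => by rw [h, B9] at A9; norm_num at A9
  have hAC : A ≠ C := fun h => by rw [h, C0] at A0; norm_num at A0
  have hBC : B ≠ C := fun h => by rw [h, C0] at B0; norm_num at B0
  have shift_eq : ∀ {a b : ℕ → ℝ}, IsDigitSeq a → IsDigitSeq b → ∀ m,
      piQ q (fun j => a (m + j)) = piQ q (fun j => b (m + j)) → b m = a m →
      piQ q (fun j => a (m + 1 + j)) = piQ q fun j => b (m + 1 + j) := by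
    intro a b ha hb m h h'
    have h1 := mul_piQ_shift hq1 ha m
    have h2 := mul_piQ_shift hq1 hb m
    rw [h, h2, h'] at h1
    linarith
  have hset : SigmaSet q (piQ q A) = {A, B, C} := by
    ext b
    simp only [SigmaSet, mem_ofPred_eq, mem_insert_iff, mem_singleton_iff]
    constructor
    · rintro ⟨hb, hval⟩
      rcases hb 0 with b0 | b0
      · have a1 := shift_eq dA hb 0 (by simpa using hval.symm) (by rw [A0, b0])
        have a2 := shift_eq dB dA 0 (by simpa using eAB) (by rw [A0, B0])
        obtain ⟨f, a9⟩ := digits_eq_of_recurs hq1 hgap dA hb a1 8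
          fun n h1 h2 => digitRecurs_lowerWord _ n (by omega) (by omega)
        obtain ⟨f', a9'⟩ := digits_eq_of_recurs hq1 hgap dA dB a2.symm 8
          fun n h1 h2 => digitRecurs_lowerWord _ n (by omega) (by omega)
        have hpre : ∀ n < 9, b n = A n := by
          intro n hn
          rcases Nat.eq_zero_or_pos n with rfl | h
          · rw [b0, A0]
          · exact f n h hn
        rcases hb 9 with b9 | b9
        · left
          have a10 := shift_eq dA hb 9 a9 (by rw [A9, b9])
          refine eq_wordThenSeq (m := 10) (fun n hn => ?_) (by norm_num)
            (tail_eq_of_recurs hq1 hgap dA hb a10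
              (digitRecurs_wordThenSeq ht (Or.inr rfl) fun n h1 h2 => if_neg (by omega)))
          rcases Nat.lt_or_ge n 9 with h | h
          · rw [hpre n h, hA, wordThenSeq_of_lt (by omega)]
          · obtain rfl : n = 9 := by omega
            simp [b9, lowerWord]
        · right; left
          have a10 := shift_eq dB hb 9 (a9'.symm.trans a9) (by rw [B9, b9])
          refine eq_wordThenSeq (m := 10) (fun n hn => ?_) (by norm_num)
            (tail_eq_of_recurs hq1 hgap dB hb a10
              (digitRecurs_wordThenSeq hs (Or.inl rfl) fun n h1 h2 => if_neg (by omega)))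
          rcases Nat.lt_or_ge n 9 with h | h
          · rcases Nat.eq_zero_or_pos n with rfl | h0
            · simp [b0, middleWord]
            · rw [hpre n h, ← f' n h0 h, hB, wordThenSeq_of_lt (by omega)]
          · obtain rfl : n = 9 := by omega
            simp [b9, middleWord]
      · right; right
        have a1 := shift_eq dC hb 0 (by simpa using eAC.trans hval.symm) (by rw [C0, b0])
        refine eq_wordThenSeq (m := 1) (fun n hn => ?_) (by norm_num)
          (tail_eq_of_recurs hq1 hgap dC hb a1
            (digitRecurs_wordThenSeq hp (Or.inl rfl) fun n h1 h2 => if_neg (by omega)))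
        obtain rfl : n = 0 := by omega
        simp [b0, upperWord]
    · rintro (rfl | rfl | rfl)
      exacts [⟨dA, rfl⟩, ⟨dB, eAB⟩, ⟨dC, eAC⟩]
  refine ⟨hq, piQ q A, piQ_mem_Icc hq1 dA, ?_⟩
  rw [hset]
  exact Set.encard_eq_three.2 ⟨A, B, C, hAB, hAC, hBC, rfl⟩

/-! ### Numerical estimates -/

lemma IsBonacci.sum_inv_pow {k : ℕ} {x : ℝ} (h : IsBonacci k x) :
    ∑ i ∈ Finset.range k, x⁻¹ ^ (i + 1) = 1 := by
  have hx : 0 < x := by linarith [h.1.1]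
  have hk : x ^ k ≠ 0 := by positivity
  refine mul_left_cancel₀ hk ?_
  calc x ^ k * ∑ i ∈ Finset.range k, x⁻¹ ^ (i + 1)
      = ∑ i ∈ Finset.range k, x ^ (k - 1 - i) := by
        rw [Finset.mul_sum]
        refine Finset.sum_congr rfl fun i hi => ?_
        have hi := Finset.mem_range.1 hi
        have e : x ^ k = x ^ (k - 1 - i) * x ^ (i + 1) := by
          rw [← pow_add]; congr 1; omega
        rw [e, inv_pow, mul_assoc, mul_inv_cancel₀ (by positivity), mul_one]
    _ = x ^ k * 1 := by rw [Finset.sum_range_reflect (fun i => x ^ i), mul_one, h.2]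

lemma IsBonacci.nine_bounds {x : ℝ} (h : IsBonacci 9 x) : 1.998 < x ∧ x < 1.99804 := by
  have hx : 0 < x := by linarith [h.1.1]
  have hs := h.sum_inv_pow
  constructor
  · by_contra! hle
    have : ∑ i ∈ Finset.range 9, (1.998 : ℝ)⁻¹ ^ (i + 1) ≤ ∑ i ∈ Finset.range 9, x⁻¹ ^ (i + 1) := by
      gcongr
    rw [hs] at this
    norm_num [Finset.sum_range_succ] at this
  · by_contra! hle
    have : ∑ i ∈ Finset.range 9, x⁻¹ ^ (i + 1) ≤
        ∑ i ∈ Finset.range 9, (1.99804 : ℝ)⁻¹ ^ (i + 1) := by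
      gcongr
    rw [hs] at this
    norm_num [Finset.sum_range_succ] at this

lemma pow_sub_pow_mem_Icc {x y : ℝ} (hx : 0 ≤ x) (hxy : x ≤ y) (hy : y ≤ 2) (n : ℕ) :
    0 ≤ y ^ n - x ^ n ∧ y ^ n - x ^ n ≤ n * 2 ^ (n - 1) * (y - x) := by
  have h0 : x ^ n ≤ y ^ n := by gcongr
  refine ⟨by linarith, ?_⟩
  have h1 : y ^ n - x ^ n = (∑ i ∈ Finset.range n, y ^ i * x ^ (n - 1 - i)) * (y - x) :=
    (Commute.all y x).geom_sum₂_mul n |>.symm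
  rw [h1]
  refine mul_le_mul_of_nonneg_right ?_ (by linarith)
  calc ∑ i ∈ Finset.range n, y ^ i * x ^ (n - 1 - i)
      ≤ ∑ i ∈ Finset.range n, (2 : ℝ) ^ (n - 1) := by
        refine Finset.sum_le_sum fun i hi => ?_
        have hi := Finset.mem_range.1 hi
        calc y ^ i * x ^ (n - 1 - i) ≤ 2 ^ i * 2 ^ (n - 1 - i) := by gcongr <;> linarith
          _ = 2 ^ (n - 1) := by rw [← pow_add]; congr 1; omega
    _ = n * 2 ^ (n - 1) := by simp

lemma IsBonacci.abs_defect_le {x q : ℝ} (h : IsBonacci 9 x) (hxq : x ≤ q) (hq : q ≤ 2) :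
    |q ^ 9 - ∑ i ∈ Finset.range 9, q ^ i| ≤ 2304 * (q - x) := by
  have h0 := h.2
  have key := fun n => pow_sub_pow_mem_Icc (by linarith [h.1.1]) hxq hq n
  have k1 := key 1
  have k2 := key 2
  have k3 := key 3
  have k4 := key 4
  have k5 := key 5
  have k6 := key 6
  have k7 := key 7
  have k8 := key 8
  have k9 := key 9
  norm_num at k1 k2 k3 k4 k5 k6 k7 k8 k9
  simp only [Finset.sum_range_succ, Finset.sum_range_zero] at h0 ⊢
  rw [abs_le]
  constructor <;> linarith

theorem B3_contains_right_neighbourhood_of_q9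
    (q9 : ℝ) (hq9 : IsBonacci 9 q9) (q : ℝ) (hq : q ∈ Set.Ioo (1 : ℝ) 2)
    (h1 : 0 < q - q9) (h2 : q - q9 ≤ q9 ^ (-24 : ℤ)) :
    q ∈ Bset 3 := by
  obtain ⟨l9, u9⟩ := hq9.nine_bounds
  have hsmall : q - q9 ≤ 1 / 10 ^ 7 := by
    refine h2.trans ?_
    rw [zpow_neg]
    have h : (1.998 : ℝ) ^ 24 ≤ q9 ^ 24 := by gcongr
    calc (q9 ^ (24 : ℤ))⁻¹ ≤ ((1.998 : ℝ) ^ 24)⁻¹ := inv_anti₀ (by positivity) (mod_cast h)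
      _ ≤ 1 / 10 ^ 7 := by norm_num
  have hl : 1.998 ≤ q := by linarith
  have hu : q ≤ 1.9981 := by norm_num at hsmall u9 ⊢; linarith
  have hgap : 1 / (q - 1) < 1 + 1 / q ^ 7 := by
    have a : 1 / (q - 1) ≤ 1 / 0.998 := one_div_le_one_div_of_le (by norm_num) (by linarith)
    have b : 1 / (2 : ℝ) ^ 7 ≤ 1 / q ^ 7 := by
      refine one_div_le_one_div_of_le (by positivity) ?_
      gcongr
      exact hq.2.le
    norm_num at a b ⊢
    linarith
  have hd := hq9.abs_defect_le (by linarith) hq.2.le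
  have hd1 : |q ^ 9 - ∑ i ∈ Finset.range 9, q ^ i| ≤ 0.0003 := by
    norm_num at hsmall ⊢; linarith
  have hd2 : |q ^ 9 * (q ^ 9 - ∑ i ∈ Finset.range 9, q ^ i)| ≤ 0.16 := by
    rw [abs_mul, abs_of_pos (by positivity)]
    calc q ^ 9 * |q ^ 9 - ∑ i ∈ Finset.range 9, q ^ i| ≤ 2 ^ 9 * 0.0003 := by
          gcongr; exact hq.2.le
      _ ≤ 0.16 := by norm_num
  obtain ⟨t, s, p, ht, hs, hp, hts, hsp⟩ := exists_blockSeqs hl hu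
    (x := (q ^ 9 - ∑ i ∈ Finset.range 9, q ^ i,
      q ^ 9 * (q ^ 9 - ∑ i ∈ Finset.range 9, q ^ i)))
    ⟨hd1.trans (by norm_num), hd2.trans (by norm_num),
      (abs_add_le _ _).trans ((add_le_add hd1 hd2).trans (by norm_num))⟩
  exact mem_Bset_three hq hgap ht hs hp hts hsp
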